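/- arXiv:2412.02179 — 4 statements merged into one kernel-verified Lean document; each statement's English description precedes it below -/
import Mathlib

section
/- Let G be a finite connected simple graph which contains a nontrivial cycle. Then Λ₁(G) = ∞, i.e. the supremum of the first nonzero eigenvalue λ₁(G, l) of the Fujiwara Laplacian over all edge-length functions l normalized by Σ_{u ∈ V} m₀(u) = 1 is infinite. -/
open Finset Filter Topology
open scoped Classical ENNReal

noncomputable section

variable {V : Type*} [Fintype V]

/-- The set of neighbors of `u` as a `Finset`. -/
def nbr (G : SimpleGraph V) (u : V) : Finset V :=
  Finset.univ.filter (fun v => G.Adj u v)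

/-- The vertex-weight `m₀(u) = ∑_{v ∼ u} l(uv)` induced by the edge-length function `l`. -/
def m0 (G : SimpleGraph V) (l : V → V → ℝ) (u : V) : ℝ :=
  ∑ v ∈ nbr G u, l u v

/-- The Fujiwara Laplacian `(Δ_l φ)(u) = ∑_{v ∼ u} (m₁(uv)/m₀(u)) (φ(u) − φ(v))`,
where `m₁(uv) = 1/l(uv)`. -/
def lap (G : SimpleGraph V) (l : V → V → ℝ) (φ : V → ℝ) (u : V) : ℝ :=
  ∑ v ∈ nbr G u, ((1 / l u v) / m0 G l u) * (φ u - φ v)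

/-- `l` is an edge-length function: symmetric and positive on adjacent pairs. -/
def IsLength (G : SimpleGraph V) (l : V → V → ℝ) : Prop :=
  (∀ u v, l u v = l v u) ∧ ∀ u v, G.Adj u v → 0 < l u v

/-- The Dirichlet energy `∑_{uv ∈ E} m₁(uv) (φ(u) − φ(v))²`
(each edge counted once, via half the sum over ordered adjacent pairs). -/
def energy (G : SimpleGraph V) (l : V → V → ℝ) (φ : V → ℝ) : ℝ :=
  (1/2) * ∑ u, ∑ v ∈ nbr G u, (1 / l u v) * (φ u - φ v) ^ 2

/-- The squared norm `∑_{u ∈ V} m₀(u) φ(u)²`. -/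
def mass (G : SimpleGraph V) (l : V → V → ℝ) (φ : V → ℝ) : ℝ :=
  ∑ u, m0 G l u * φ u ^ 2

/-- The first nonzero eigenvalue of the Fujiwara Laplacian, via its variational
characterization as the infimum of the Rayleigh quotient over nonzero functions
orthogonal to the constants. -/
def lambda1 (G : SimpleGraph V) (l : V → V → ℝ) : ℝ :=
  sInf { r | ∃ φ : V → ℝ, φ ≠ 0 ∧ (∑ u, m0 G l u * φ u) = 0 ∧
    r = energy G l φ / mass G l φ }

/-- The largest eigenvalue of the Fujiwara Laplacian, via its variational
characterization as the supremum of the Rayleigh quotient. -/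
def lambdaMax (G : SimpleGraph V) (l : V → V → ℝ) : ℝ :=
  sSup { r | ∃ φ : V → ℝ, φ ≠ 0 ∧ r = energy G l φ / mass G l φ }

/-- `Λ₁(G)`: the supremum, in `[0, ∞]`, of `λ₁(G, l)` over all edge-length functions `l`
normalized by `∑_{u ∈ V} m₀(u) = 1`. -/
def Lambda1 (G : SimpleGraph V) : ℝ≥0∞ :=
  ⨆ (l : V → V → ℝ) (_ : IsLength G l ∧ (∑ u, m0 G l u) = 1),
    ENNReal.ofReal (lambda1 G l)

/-- `μ` is the nondecreasing sequence of eigenvalues (with multiplicity) of the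
Fujiwara Laplacian `Δ_l`: it is monotone and admits a corresponding family of
eigenfunctions that is orthonormal for the inner product `⟨φ, ψ⟩ = ∑ m₀(u) φ(u) ψ(u)`. -/
def IsLapEigSeq (G : SimpleGraph V) (l : V → V → ℝ)
    (μ : Fin (Fintype.card V) → ℝ) : Prop :=
  Monotone μ ∧ ∃ φ : Fin (Fintype.card V) → V → ℝ,
    (∀ i u, lap G l (φ i) u = μ i * φ i u) ∧
    (∀ i j, (∑ u, m0 G l u * φ i u * φ j u) = if i = j then 1 else 0)

lemma mem_nbr {G : SimpleGraph V} {u v : V} : v ∈ nbr G u ↔ G.Adj u v := by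
  simp [nbr]

lemma m0_pos {G : SimpleGraph V} {l : V → V → ℝ} (hl : IsLength G l) {u v : V}
    (huv : G.Adj u v) : 0 < m0 G l u :=
  Finset.sum_pos (fun w hw => hl.2 u w (mem_nbr.1 hw)) ⟨v, mem_nbr.2 huv⟩

lemma m0_nonneg {G : SimpleGraph V} {l : V → V → ℝ} (hl : IsLength G l) (u : V) :
    0 ≤ m0 G l u :=
  Finset.sum_nonneg fun w hw => (hl.2 u w (mem_nbr.1 hw)).le

lemma energy_term_nonneg {G : SimpleGraph V} {l : V → V → ℝ} (hl : IsLength G l)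
    (φ : V → ℝ) (u v : V) (hv : v ∈ nbr G u) : 0 ≤ (1 / l u v) * (φ u - φ v) ^ 2 :=
  mul_nonneg (one_div_nonneg.2 (hl.2 u v (mem_nbr.1 hv)).le) (sq_nonneg _)

lemma energy_nonneg {G : SimpleGraph V} {l : V → V → ℝ} (hl : IsLength G l) (φ : V → ℝ) :
    0 ≤ energy G l φ :=
  mul_nonneg (by norm_num) <| Finset.sum_nonneg fun u _ =>
    Finset.sum_nonneg fun v hv => energy_term_nonneg hl φ u v hv

/-- The increment of `φ` along an edge is controlled by the length of the edge and the energy. -/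
lemma sq_sub_le_length_mul_energy {G : SimpleGraph V} {l : V → V → ℝ} (hl : IsLength G l)
    (φ : V → ℝ) {u v : V} (huv : G.Adj u v) :
    (φ u - φ v) ^ 2 ≤ 2 * l u v * energy G l φ := by
  have hpos := hl.2 u v huv
  have hterm : (1 / l u v) * (φ u - φ v) ^ 2 ≤
      ∑ u, ∑ v ∈ nbr G u, (1 / l u v) * (φ u - φ v) ^ 2 :=
    (Finset.single_le_sum (f := fun v => (1 / l u v) * (φ u - φ v) ^ 2)
      (fun w hw => energy_term_nonneg hl φ u w hw) (mem_nbr.2 huv)).trans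
    (Finset.single_le_sum (f := fun u => ∑ v ∈ nbr G u, (1 / l u v) * (φ u - φ v) ^ 2)
      (fun w _ => Finset.sum_nonneg fun x hx => energy_term_nonneg hl φ w x hx)
      (Finset.mem_univ u))
  calc (φ u - φ v) ^ 2 = l u v * ((1 / l u v) * (φ u - φ v) ^ 2) := by field_simp
    _ ≤ l u v * ∑ u, ∑ v ∈ nbr G u, (1 / l u v) * (φ u - φ v) ^ 2 := by gcongr
    _ = 2 * l u v * energy G l φ := by unfold energy; ring

lemma abs_sub_le_walk_length_mul {W : Type*} {H : SimpleGraph W} {φ : W → ℝ} {B : ℝ}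
    (hB : ∀ u v, H.Adj u v → |φ u - φ v| ≤ B) {x y : W} (p : H.Walk x y) :
    |φ x - φ y| ≤ p.length * B := by
  induction p with
  | nil => simp
  | @cons u v w h p ih =>
    have := abs_sub_le (φ u) (φ v) (φ w)
    have := hB _ _ h
    rw [SimpleGraph.Walk.length_cons]
    push_cast
    linarith

lemma abs_sub_le_card_mul {H : SimpleGraph V} (hH : H.Connected) {φ : V → ℝ} {B : ℝ}
    (hB₀ : 0 ≤ B) (hB : ∀ u v, H.Adj u v → |φ u - φ v| ≤ B) (x y : V) :
    |φ x - φ y| ≤ Fintype.card V * B := by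
  obtain ⟨p, hp⟩ := hH.exists_isPath x y
  refine (abs_sub_le_walk_length_mul hB p).trans ?_
  gcongr
  exact hp.length_lt.le

/-- A function of mean zero whose oscillation is at most `D` has mass at most `D ^ 2`. -/
lemma mass_le_sq_of_osc_le {G : SimpleGraph V} {l : V → V → ℝ} (hl : IsLength G l)
    (hsum : ∑ u, m0 G l u = 1) {φ : V → ℝ} (hmean : ∑ u, m0 G l u * φ u = 0) {D : ℝ}
    (hD : ∀ x y, |φ x - φ y| ≤ D) : mass G l φ ≤ D ^ 2 := by
  have hφ (u : V) : |φ u| ≤ D := by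
    have hu : φ u = ∑ v, m0 G l v * (φ u - φ v) := by
      simp_rw [mul_sub, Finset.sum_sub_distrib, hmean, ← Finset.sum_mul, hsum]
      ring
    rw [hu]
    calc |∑ v, m0 G l v * (φ u - φ v)| ≤ ∑ v, |m0 G l v * (φ u - φ v)| :=
          Finset.abs_sum_le_sum_abs _ _
      _ ≤ ∑ v, m0 G l v * D := by
          refine Finset.sum_le_sum fun v _ => ?_
          rw [abs_mul, abs_of_nonneg (m0_nonneg hl v)]
          exact mul_le_mul_of_nonneg_left (hD u v) (m0_nonneg hl v)
      _ = D := by rw [← Finset.sum_mul, hsum, one_mul]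
  calc mass G l φ ≤ ∑ u, m0 G l u * D ^ 2 :=
        Finset.sum_le_sum fun u _ => mul_le_mul_of_nonneg_left
          (sq_le_sq.2 ((hφ u).trans (le_abs_self D))) (m0_nonneg hl u)
    _ = D ^ 2 := by rw [← Finset.sum_mul, hsum, one_mul]

/-- If the edges of length at most `δ` contain a connected spanning subgraph, then the mass of a
function of mean zero is controlled by `δ` times its energy. -/
lemma mass_le_mul_energy {G H : SimpleGraph V} (hH : H.Connected) (hHG : H ≤ G)
    {l : V → V → ℝ} (hl : IsLength G l) (hsum : ∑ u, m0 G l u = 1) {δ : ℝ} (hδ : 0 ≤ δ)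
    (hle : ∀ u v, H.Adj u v → l u v ≤ δ) {φ : V → ℝ} (hmean : ∑ u, m0 G l u * φ u = 0) :
    mass G l φ ≤ 2 * (Fintype.card V : ℝ) ^ 2 * δ * energy G l φ := by
  have hE := energy_nonneg hl φ
  have hB (u v : V) (huv : H.Adj u v) : |φ u - φ v| ≤ √(2 * δ * energy G l φ) := by
    refine Real.abs_le_sqrt ((sq_sub_le_length_mul_energy hl φ (hHG huv)).trans ?_)
    have := hle u v huv
    gcongr
  refine (mass_le_sq_of_osc_le hl hsum hmean
    (abs_sub_le_card_mul hH (Real.sqrt_nonneg _) hB)).trans_eq ?_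
  rw [mul_pow, Real.sq_sqrt (by positivity)]
  ring

lemma mass_pos {G : SimpleGraph V} {l : V → V → ℝ} (hpos : ∀ u, 0 < m0 G l u) {φ : V → ℝ}
    (hφ : φ ≠ 0) : 0 < mass G l φ := by
  obtain ⟨u, hu⟩ := Function.ne_iff.1 hφ
  exact Finset.sum_pos' (fun v _ => mul_nonneg (hpos v).le (sq_nonneg _))
    ⟨u, Finset.mem_univ u, mul_pos (hpos u) (sq_pos_of_ne_zero hu)⟩

lemma le_lambda1 [Nontrivial V] {G : SimpleGraph V} {l : V → V → ℝ}
    (hpos : ∀ u, 0 < m0 G l u) {K : ℝ}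
    (h : ∀ φ : V → ℝ, ∑ u, m0 G l u * φ u = 0 → K * mass G l φ ≤ energy G l φ) :
    K ≤ lambda1 G l := by
  refine le_csInf ?_ ?_
  · obtain ⟨a, b, hab⟩ := exists_pair_ne V
    refine ⟨_, Pi.single a (m0 G l b) - Pi.single b (m0 G l a), ?_, ?_, rfl⟩
    · intro h0
      have := congrFun h0 a
      simp [hab, (hpos b).ne'] at this
    · simp [mul_sub, Finset.sum_sub_distrib, Pi.single_apply, mul_comm]
  · rintro r ⟨φ, hφ, hmean, rfl⟩
    exact (le_div_iff₀ (mass_pos hpos hφ)).2 (h φ hmean)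

lemma sum_m0_div (G : SimpleGraph V) (l : V → V → ℝ) (c : ℝ) :
    ∑ u, m0 G (fun x y => l x y / c) u = (∑ u, m0 G l u) / c := by
  simp [m0, Finset.sum_div]

/-- There are normalized lengths that are arbitrarily small away from a given edge. -/
lemma exists_isLength_le_off_edge {G : SimpleGraph V} {a b : V} (hab : G.Adj a b) {δ : ℝ}
    (hδ : 0 < δ) : ∃ l : V → V → ℝ, IsLength G l ∧ ∑ u, m0 G l u = 1 ∧
      ∀ u v, s(u, v) ≠ s(a, b) → l u v ≤ δ := by
  set l : V → V → ℝ := fun u v => if s(u, v) = s(a, b) then 1 else δ with hl_def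
  have hlpos (u v : V) : 0 < l u v := by simp only [hl_def]; split_ifs <;> positivity
  have hl : IsLength G l :=
    ⟨fun u v => by simp only [hl_def, Sym2.eq_swap (a := u)], fun u v _ => hlpos u v⟩
  have hS : 1 ≤ ∑ u, m0 G l u :=
    calc (1 : ℝ) = l a b := by simp [hl_def]
      _ ≤ m0 G l a := Finset.single_le_sum (f := l a) (fun v _ => (hlpos a v).le)
          (mem_nbr.2 hab)
      _ ≤ ∑ u, m0 G l u := Finset.single_le_sum (f := m0 G l) (fun u _ => m0_nonneg hl u)
          (Finset.mem_univ a)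
  have hS₀ : 0 < ∑ u, m0 G l u := one_pos.trans_le hS
  refine ⟨fun u v => l u v / ∑ w, m0 G l w,
    ⟨fun u v => congrArg (· / _) (hl.1 u v), fun u v _ => div_pos (hlpos u v) hS₀⟩, ?_,
    fun u v huv => ?_⟩
  · rw [sum_m0_div, div_self hS₀.ne']
  · refine (div_le_self (hlpos u v).le hS).trans_eq ?_
    simp only [hl_def, if_neg huv]

/-- **Main Theorem.** If a finite connected simple graph `G` contains a nontrivial cycle,
then `Λ₁(G) = ∞`: the supremum of the first nonzero eigenvalue `λ₁(G, l)` of the Fujiwara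
Laplacian, over all edge-length functions `l` normalized by `∑_{u ∈ V} m₀(u) = 1`,
is infinite. -/
theorem lambda1_sup_eq_top_of_exists_cycle {V : Type*} [Fintype V] (G : SimpleGraph V)
    (hconn : G.Connected) (hcyc : ∃ (v : V) (w : G.Walk v v), w.IsCycle) :
    Lambda1 G = ⊤ := by
  obtain ⟨a, b, hab, hbr⟩ : ∃ a b, G.Adj a b ∧ ¬ G.IsBridge s(a, b) := by
    obtain ⟨v, w, hw⟩ := hcyc
    by_contra! h
    exact SimpleGraph.isAcyclic_iff_forall_adj_isBridge.2 (fun a b => h a b) w hw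
  have : Nontrivial V := ⟨a, b, hab.ne⟩
  have hH := hconn.connected_delete_edge_of_not_isBridge hbr
  refine ENNReal.eq_top_of_forall_nnreal_le fun K => ?_
  have hn : (0 : ℝ) < Fintype.card V := by exact_mod_cast Fintype.card_pos
  set δ : ℝ := 1 / (2 * (Fintype.card V : ℝ) ^ 2 * (K + 1)) with hδ_def
  have hδ : 0 < δ := by positivity
  obtain ⟨l, hl, hsum, hle⟩ := exists_isLength_le_off_edge hab hδ
  have hpos (u : V) : 0 < m0 G l u := by
    obtain ⟨v, huv⟩ := hconn.preconnected.exists_adj_of_nontrivial u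
    exact m0_pos hl huv
  have hK : (K : ℝ) ≤ lambda1 G l := by
    refine le_lambda1 hpos fun φ hmean => ?_
    have hmass := mass_le_mul_energy hH (SimpleGraph.deleteEdges_le _) hl hsum hδ.le
      (fun u v huv => hle u v (by simpa using (SimpleGraph.deleteEdges_adj.1 huv).2)) hmean
    have hE := energy_nonneg hl φ
    calc (K : ℝ) * mass G l φ
        ≤ K * (2 * (Fintype.card V : ℝ) ^ 2 * δ * energy G l φ) := by gcongr
      _ = K / (K + 1) * energy G l φ := by rw [hδ_def]; field_simp
      _ ≤ energy G l φ :=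
          mul_le_of_le_one_left hE ((div_le_one (by positivity)).2 (by linarith))
  calc (K : ℝ≥0∞) = ENNReal.ofReal K := (ENNReal.ofReal_coe_nnreal).symm
    _ ≤ ENNReal.ofReal (lambda1 G l) := ENNReal.ofReal_le_ofReal hK
    _ ≤ Lambda1 G := le_iSup₂_of_le l ⟨hl, hsum⟩ le_rfl

end
end

section
/- For every n ≥ 3 there exist constants C′ > 0 and ε > 0 such that for all t ∈ (0, ε) and all k with 2 ≤ k ≤ n−1, the k-th smallest eigenvalue (counted with multiplicity, starting from λ₀ = 0) of the Fujiwara Laplacian of the cycle C_n with the edge-length function l_t satisfies λ_k(C_n, l_t) ≥ C′/t². -/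
open Finset Filter Topology
open scoped Classical ENNReal

noncomputable section

variable {V : Type*} [Fintype V]

/-- The edge-length function `l_t` on the cycle graph `C_n` (vertices `0, …, n−1`
corresponding to `1, …, n`): the edge `{n−2, n−1}` (i.e. `{n−1, n}` in `1`-based labels)
has length `1`, and all other edges (`{i, i+1}` for `0 ≤ i ≤ n−3`, and `{n−1, 0}`)
have length `t`. -/
def cycleLen (n : ℕ) (t : ℝ) (i j : Fin n) : ℝ :=
  if (i.val = n - 2 ∧ j.val = n - 1) ∨ (i.val = n - 1 ∧ j.val = n - 2) then 1 else t

section MinMax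

variable {V : Type*} [Fintype V] {G : SimpleGraph V} {l : V → V → ℝ}

/-- Green's formula: `⟨ψ, Δ_l ψ⟩` is the Dirichlet energy of `ψ`. -/
theorem sum_m0_mul_lap_eq_energy (hl : ∀ u v, l u v = l v u) (hm : ∀ u, m0 G l u ≠ 0)
    (ψ : V → ℝ) : ∑ u, m0 G l u * ψ u * lap G l ψ u = energy G l ψ := by
  have hsum : ∑ u, m0 G l u * ψ u * lap G l ψ u
      = ∑ u, ∑ v, if G.Adj u v then (1 / l u v) * (ψ u - ψ v) * ψ u else 0 := by
    refine Finset.sum_congr rfl fun u _ => ?_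
    rw [lap, Finset.mul_sum, nbr, Finset.sum_filter]
    refine Finset.sum_congr rfl fun v _ => ?_
    split_ifs
    · have := hm u
      field_simp
    · rfl
  have hswap : ∑ u, m0 G l u * ψ u * lap G l ψ u
      = ∑ u, ∑ v, if G.Adj u v then -((1 / l u v) * (ψ u - ψ v) * ψ v) else 0 := by
    rw [hsum, Finset.sum_comm]
    refine Finset.sum_congr rfl fun u _ => Finset.sum_congr rfl fun v _ => ?_
    simp only [G.adj_comm v u, hl v u]
    split_ifs
    · ring
    · rfl
  have hadd : ∑ u, m0 G l u * ψ u * lap G l ψ u + ∑ u, m0 G l u * ψ u * lap G l ψ u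
      = ∑ u, ∑ v ∈ nbr G u, (1 / l u v) * (ψ u - ψ v) ^ 2 := by
    nth_rewrite 1 [hsum]
    rw [hswap, ← Finset.sum_add_distrib]
    refine Finset.sum_congr rfl fun u _ => ?_
    rw [← Finset.sum_add_distrib, nbr, Finset.sum_filter]
    refine Finset.sum_congr rfl fun v _ => ?_
    split_ifs
    · ring
    · simp
  rw [energy, ← hadd]
  ring

/-- The Laplacian of a linear combination of eigenfunctions. -/
theorem lap_sum_smul {ι : Type*} [Fintype ι] (c μ : ι → ℝ) (φ : ι → V → ℝ)
    (h : ∀ i u, lap G l (φ i) u = μ i * φ i u) (u : V) :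
    lap G l (fun v => ∑ i, c i * φ i v) u = ∑ i, c i * μ i * φ i u := by
  have : ∀ i, c i * μ i * φ i u = c i * lap G l (φ i) u := fun i => by rw [h]; ring
  simp only [this, lap, Finset.mul_sum]
  rw [Finset.sum_comm]
  refine Finset.sum_congr rfl fun v _ => ?_
  rw [← Finset.sum_sub_distrib, Finset.mul_sum]
  exact Finset.sum_congr rfl fun i _ => by ring

/-- Pairing of two linear combinations of an orthonormal family. -/
theorem sum_m0_mul_sum_mul_sum {ι : Type*} [Fintype ι] [DecidableEq ι] (c d : ι → ℝ) (φ : ι → V → ℝ)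
    (h : ∀ i j, (∑ u, m0 G l u * φ i u * φ j u) = if i = j then 1 else 0) :
    ∑ u, m0 G l u * (∑ i, c i * φ i u) * (∑ j, d j * φ j u) = ∑ i, c i * d i := by
  calc ∑ u, m0 G l u * (∑ i, c i * φ i u) * (∑ j, d j * φ j u)
      = ∑ u, ∑ i, ∑ j, c i * d j * (m0 G l u * φ i u * φ j u) := by
        refine Finset.sum_congr rfl fun u _ => ?_
        rw [mul_assoc, Finset.sum_mul_sum, Finset.mul_sum]
        refine Finset.sum_congr rfl fun i _ => ?_
        rw [Finset.mul_sum]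
        exact Finset.sum_congr rfl fun j _ => by ring
    _ = ∑ i, ∑ j, c i * d j * ∑ u, m0 G l u * φ i u * φ j u := by
        rw [Finset.sum_comm]
        refine Finset.sum_congr rfl fun i _ => ?_
        rw [Finset.sum_comm]
        exact Finset.sum_congr rfl fun j _ => by rw [Finset.mul_sum]
    _ = ∑ i, c i * d i := by simp [h]

/-- The easy half of the min-max principle: under `m ≤ k` linear constraints there is a
function of positive mass whose Rayleigh quotient is at most the `k`-th eigenvalue. -/
theorem IsLapEigSeq.exists_energy_le {μ : Fin (Fintype.card V) → ℝ}
    (hμ : IsLapEigSeq G l μ) (hl : ∀ u v, l u v = l v u) (hm : ∀ u, m0 G l u ≠ 0)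
    {m : ℕ} (L : (V → ℝ) →ₗ[ℝ] (Fin m → ℝ)) (k : Fin (Fintype.card V)) (hk : m ≤ k) :
    ∃ ψ : V → ℝ, L ψ = 0 ∧ 0 < mass G l ψ ∧ energy G l ψ ≤ μ k * mass G l ψ := by
  obtain ⟨hmono, φ, heig, horth⟩ := hμ
  let e : Fin (k + 1) → Fin (Fintype.card V) := Fin.castLE k.isLt
  let S : (Fin (k + 1) → ℝ) →ₗ[ℝ] (V → ℝ) := Fintype.linearCombination ℝ (fun i => φ (e i))
  have hS : ∀ c, S c = fun u => ∑ i, c i * φ (e i) u := fun c => by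
    ext u
    simp [S, Fintype.linearCombination_apply]
  have hker : LinearMap.ker (L ∘ₗ S) ≠ ⊥ := by
    apply LinearMap.ker_ne_bot_of_finrank_lt
    simp only [Module.finrank_fin_fun]
    omega
  obtain ⟨c, hc, hc0⟩ := (Submodule.ne_bot_iff _).1 hker
  have horth' : ∀ i j, (∑ u, m0 G l u * φ (e i) u * φ (e j) u) = if i = j then 1 else 0 :=
    fun i j => by
      rw [horth]
      simp [e]
  have hmass : mass G l (S c) = ∑ i, c i * c i := by
    rw [← sum_m0_mul_sum_mul_sum c c _ horth', mass, hS]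
    exact Finset.sum_congr rfl fun u _ => by ring
  have henergy : energy G l (S c) = ∑ i, c i * (c i * μ (e i)) := by
    rw [← sum_m0_mul_lap_eq_energy hl hm, ← sum_m0_mul_sum_mul_sum c _ _ horth', hS]
    refine Finset.sum_congr rfl fun u _ => ?_
    rw [lap_sum_smul c (fun i => μ (e i)) _ fun i => heig (e i)]
  refine ⟨S c, hc, ?_, ?_⟩
  · obtain ⟨i, hi⟩ := Function.ne_iff.1 hc0
    rw [hmass]
    exact Finset.sum_pos' (fun j _ => mul_self_nonneg _)
      ⟨i, Finset.mem_univ _, mul_self_pos.2 hi⟩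
  · rw [hmass, henergy, Finset.mul_sum]
    refine Finset.sum_le_sum fun i _ => ?_
    have hle : μ (e i) ≤ μ k := hmono (Fin.le_def.2 (Nat.lt_succ_iff.1 i.isLt))
    nlinarith [mul_self_nonneg (c i)]

/-- The energy controls the increment of a function along each edge. -/
theorem sq_sub_le_energy (hpos : ∀ u v, G.Adj u v → 0 < l u v) {u v : V} (huv : G.Adj u v)
    (ψ : V → ℝ) : (ψ u - ψ v) ^ 2 ≤ 2 * l u v * energy G l ψ := by
  have hterm : ∀ x, ∀ y ∈ nbr G x, 0 ≤ (1 / l x y) * (ψ x - ψ y) ^ 2 := fun x y hy => by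
    have := hpos x y (by simpa [nbr] using hy)
    positivity
  have hle : (1 / l u v) * (ψ u - ψ v) ^ 2 ≤ 2 * energy G l ψ :=
    calc (1 / l u v) * (ψ u - ψ v) ^ 2
        ≤ ∑ y ∈ nbr G u, (1 / l u y) * (ψ u - ψ y) ^ 2 :=
          Finset.single_le_sum (f := fun y => (1 / l u y) * (ψ u - ψ y) ^ 2) (hterm u)
            (by simpa [nbr] using huv)
      _ ≤ ∑ x, ∑ y ∈ nbr G x, (1 / l x y) * (ψ x - ψ y) ^ 2 :=
          Finset.single_le_sum
            (f := fun x => ∑ y ∈ nbr G x, (1 / l x y) * (ψ x - ψ y) ^ 2)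
            (fun x _ => Finset.sum_nonneg (hterm x)) (Finset.mem_univ u)
      _ = 2 * energy G l ψ := by
          rw [energy]
          ring
  have hl := hpos u v huv
  rw [one_div_mul_eq_div, div_le_iff₀ hl] at hle
  linarith

end MinMax

section Cycle

variable {n : ℕ} {t : ℝ}

theorem cycleLen_comm (u v : Fin n) : cycleLen n t u v = cycleLen n t v u := by
  unfold cycleLen
  congr 1
  apply propext
  tauto

theorem cycleLen_pos (ht : 0 < t) (u v : Fin n) : 0 < cycleLen n t u v := by
  unfold cycleLen
  split_ifs
  exacts [one_pos, ht]

theorem cycleGraph_adj_of_succ {i j : Fin n} (h : j.val = i.val + 1) :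
    (SimpleGraph.cycleGraph n).Adj i j := by
  rw [SimpleGraph.cycleGraph_adj']
  right
  rw [Fin.sub_val_of_le (Fin.le_def.2 (by omega))]
  omega

theorem m0_cycle_pos (hn : 3 ≤ n) (ht : 0 < t) (u : Fin n) :
    0 < m0 (SimpleGraph.cycleGraph n) (cycleLen n t) u := by
  refine Finset.sum_pos (fun v _ => cycleLen_pos ht u v) ?_
  by_cases hu : u.val = 0
  · refine ⟨⟨1, by omega⟩, ?_⟩
    simpa [nbr] using cycleGraph_adj_of_succ (i := u) (j := ⟨1, by omega⟩) (by simp [hu])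
  · refine ⟨⟨u.val - 1, by omega⟩, ?_⟩
    have h := cycleGraph_adj_of_succ (i := ⟨u.val - 1, by omega⟩) (j := u)
      (by simp only; omega)
    simpa [nbr] using h.symm

theorem m0_cycle_le (ht : 0 < t) (u : Fin n) (hu : u.val < n - 2) :
    m0 (SimpleGraph.cycleGraph n) (cycleLen n t) u ≤ n * t := by
  have hlen : ∀ v, cycleLen n t u v = t := fun v => by
    rw [cycleLen, if_neg]
    omega
  have hcard : ((nbr (SimpleGraph.cycleGraph n) u).card : ℝ) ≤ n := by
    exact_mod_cast (Finset.card_le_univ _).trans_eq (Fintype.card_fin n)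
  simp only [m0, hlen, Finset.sum_const, nsmul_eq_mul]
  gcongr

/-- A function vanishing at the vertex `n - 2` is bounded by its energy along the path
`0, …, n - 2` of edges of length `t`. -/
theorem abs_le_mul_sqrt_energy (hn : 3 ≤ n) (ht : 0 < t) {ψ : Fin n → ℝ}
    (hψ : ∀ i : Fin n, i.val = n - 2 → ψ i = 0) (j : ℕ) (i : Fin n) (hij : i.val + j = n - 2) :
    |ψ i| ≤ j * √(2 * t * energy (SimpleGraph.cycleGraph n) (cycleLen n t) ψ) := by
  induction j generalizing i with
  | zero => simp [hψ i (by omega)]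
  | succ j ih =>
    let i' : Fin n := ⟨i.val + 1, by omega⟩
    have hnext := ih i' (by simp only [i']; omega)
    have hlen : cycleLen n t i i' = t := by
      rw [cycleLen, if_neg]
      simp only [i']
      omega
    have hstep := sq_sub_le_energy (fun u v _ => cycleLen_pos ht u v)
      (cycleGraph_adj_of_succ (i := i) (j := i') rfl) ψ
    rw [hlen] at hstep
    have habs := Real.abs_le_sqrt hstep
    have htri : |ψ i| ≤ |ψ i - ψ i'| + |ψ i'| := by
      simpa using abs_add_le (ψ i - ψ i') (ψ i')
    push_cast
    linarith

/-- A Poincaré inequality for functions vanishing at the endpoints of the long edge. -/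
theorem mass_cycle_le_energy (hn : 3 ≤ n) (ht : 0 < t) {ψ : Fin n → ℝ}
    (hψ : ∀ i : Fin n, n - 2 ≤ i.val → ψ i = 0) :
    mass (SimpleGraph.cycleGraph n) (cycleLen n t) ψ
      ≤ 2 * n ^ 4 * t ^ 2 * energy (SimpleGraph.cycleGraph n) (cycleLen n t) ψ := by
  set E := energy (SimpleGraph.cycleGraph n) (cycleLen n t) ψ with hE
  have hE0 : 0 ≤ E := by
    have h := sq_sub_le_energy (fun u v _ => cycleLen_pos ht u v) (cycleGraph_adj_of_succ
      (i := (⟨0, by omega⟩ : Fin n)) (j := ⟨1, by omega⟩) rfl) ψ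
    have hl := cycleLen_pos ht (⟨0, by omega⟩ : Fin n) ⟨1, by omega⟩
    exact nonneg_of_mul_nonneg_right ((sq_nonneg _).trans h) (by positivity)
  have hterm : ∀ u : Fin n, m0 (SimpleGraph.cycleGraph n) (cycleLen n t) u * ψ u ^ 2
      ≤ 2 * n ^ 3 * t ^ 2 * E := fun u => by
    by_cases hu : n - 2 ≤ u.val
    · rw [hψ u hu]
      simp only [ne_eq, OfNat.ofNat_ne_zero, not_false_eq_true, zero_pow, mul_zero]
      positivity
    · have habs := abs_le_mul_sqrt_energy hn ht (fun i hi => hψ i hi.ge) (n - 2 - u.val) u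
        (by omega)
      have hle : |ψ u| ≤ n * √(2 * t * E) := habs.trans (by
        gcongr
        omega)
      have hsq : ψ u ^ 2 ≤ n ^ 2 * (2 * t * E) := by
        rw [← sq_abs, ← Real.sq_sqrt (show 0 ≤ 2 * t * E by positivity), ← mul_pow]
        gcongr
      calc m0 (SimpleGraph.cycleGraph n) (cycleLen n t) u * ψ u ^ 2
          ≤ (n * t) * (n ^ 2 * (2 * t * E)) := by
            gcongr
            exact m0_cycle_le ht u (by omega)
        _ = 2 * n ^ 3 * t ^ 2 * E := by ring
  calc mass (SimpleGraph.cycleGraph n) (cycleLen n t) ψ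
      ≤ ∑ _u : Fin n, 2 * n ^ 3 * t ^ 2 * E := Finset.sum_le_sum fun u _ => hterm u
    _ = 2 * n ^ 4 * t ^ 2 * E := by
      simp only [Finset.sum_const, Finset.card_univ, Fintype.card_fin, nsmul_eq_mul]
      ring

end Cycle

/-- For every `n ≥ 3` there are constants `C′ > 0` and `ε > 0` such that for all
`t ∈ (0, ε)` and all `k` with `2 ≤ k ≤ n−1`, the `k`-th smallest eigenvalue (with
multiplicity, starting from `λ₀ = 0`) of the Fujiwara Laplacian of the cycle `C_n`
with edge-length function `l_t` satisfies `λ_k(C_n, l_t) ≥ C′/t²`. -/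
theorem cycleGraph_lambdaK_lower_bound (n : ℕ) (hn : 3 ≤ n) :
    ∃ C > (0 : ℝ), ∃ ε > (0 : ℝ), ∀ t ∈ Set.Ioo (0 : ℝ) ε,
      ∀ μ : Fin (Fintype.card (Fin n)) → ℝ,
        IsLapEigSeq (SimpleGraph.cycleGraph n) (cycleLen n t) μ →
        ∀ k : Fin (Fintype.card (Fin n)), 2 ≤ (k : ℕ) → C / t ^ 2 ≤ μ k := by
  have hn0 : (0 : ℝ) < n := by exact_mod_cast (show 0 < n by omega)
  refine ⟨1 / (2 * n ^ 4), by positivity, 1, one_pos, fun t ht μ hμ k hk => ?_⟩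
  have ht0 : 0 < t := ht.1
  let ends : Fin 2 → Fin n := fun i => ⟨n - 2 + i.val, by omega⟩
  obtain ⟨ψ, hψ, hmass, hle⟩ := hμ.exists_energy_le cycleLen_comm
    (fun u => (m0_cycle_pos hn ht0 u).ne') (LinearMap.funLeft ℝ ℝ ends) k hk
  have hzero : ∀ i : Fin n, n - 2 ≤ i.val → ψ i = 0 := fun i hi => by
    have h := congrFun hψ ⟨i.val - (n - 2), by omega⟩
    have hi' : ends ⟨i.val - (n - 2), by omega⟩ = i := Fin.ext (by simp only [ends]; omega)
    rwa [LinearMap.funLeft_apply, hi'] at h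
  have hpoinc := mass_cycle_le_energy hn ht0 hzero
  have hchain : 1 * mass (SimpleGraph.cycleGraph n) (cycleLen n t) ψ
      ≤ (2 * n ^ 4 * t ^ 2 * μ k) * mass (SimpleGraph.cycleGraph n) (cycleLen n t) ψ := by
    rw [one_mul, mul_assoc _ (μ k)]
    exact hpoinc.trans (by gcongr)
  have hone := le_of_mul_le_mul_right hchain hmass
  rw [div_div, div_le_iff₀ (by positivity)]
  linarith

end
end

section
/- Under the stated hypotheses on the family Ã(t), for every k with 0 ≤ k ≤ n−1 the eigenvalue λ̃_k(t) of Ã(t) converges to the eigenvalue λ_k of A as t → 0⁺. -/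
open Filter Topology

noncomputable section

/-- `μ` is the nondecreasing sequence of eigenvalues, counted with multiplicity, of the
real symmetric matrix `M`: it is monotone and admits a corresponding family of
eigenvectors that is orthonormal for the Euclidean inner product. -/
def IsEigSeq {m : ℕ} (M : Matrix (Fin m) (Fin m) ℝ) (μ : Fin m → ℝ) : Prop :=
  Monotone μ ∧ ∃ v : Fin m → (Fin m → ℝ),
    (∀ i, M.mulVec (v i) = fun j => μ i * v i j) ∧
    (∀ i j, (∑ k, v i k * v j k) = if i = j then 1 else 0)

/-- Expansion of the Euclidean norm and of the quadratic form in an orthonormal eigenbasis. -/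
theorem IsEigSeq.exists_coordinates {m : ℕ} {M : Matrix (Fin m) (Fin m) ℝ} {μ : Fin m → ℝ}
    (h : IsEigSeq M μ) :
    ∃ V : Matrix (Fin m) (Fin m) ℝ, ∀ x : Fin m → ℝ,
      x ⬝ᵥ x = ∑ i, (V.mulVec x i) ^ 2 ∧
      x ⬝ᵥ M.mulVec x = ∑ i, μ i * (V.mulVec x i) ^ 2 := by
  obtain ⟨-, v, hv, ho⟩ := h
  set V : Matrix (Fin m) (Fin m) ℝ := Matrix.of v with hV
  have hVV : V * V.transpose = 1 := by
    ext i j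
    simp [Matrix.mul_apply, hV, ho, Matrix.one_apply]
  have hVV' : V.transpose * V = 1 := mul_eq_one_comm.mp hVV
  have hMV : M * V.transpose = V.transpose * Matrix.diagonal μ := by
    ext j i
    have := congrFun (hv i) j
    rw [Matrix.mul_diagonal]
    simpa [Matrix.mul_apply, Matrix.mulVec, dotProduct, hV, mul_comm] using this
  refine ⟨V, fun x => ?_⟩
  have hx : x = V.transpose.mulVec (V.mulVec x) := by
    rw [Matrix.mulVec_mulVec, hVV', Matrix.one_mulVec]
  have hdot : ∀ y, x ⬝ᵥ V.transpose.mulVec y = V.mulVec x ⬝ᵥ y := fun y => by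
    rw [Matrix.dotProduct_mulVec, Matrix.vecMul_transpose]
  constructor
  · calc x ⬝ᵥ x = x ⬝ᵥ V.transpose.mulVec (V.mulVec x) := by rw [← hx]
      _ = _ := by rw [hdot]; simp [dotProduct, sq]
  · calc x ⬝ᵥ M.mulVec x = x ⬝ᵥ M.mulVec (V.transpose.mulVec (V.mulVec x)) := by rw [← hx]
      _ = _ := by
        rw [Matrix.mulVec_mulVec, hMV, ← Matrix.mulVec_mulVec, hdot]
        simp only [dotProduct, Matrix.mulVec_diagonal]
        exact Finset.sum_congr rfl fun i _ => by ring

/-- The dimension count behind the min-max principle, along a linear map. -/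
theorem IsEigSeq.exists_test_vector {p q : ℕ} {M : Matrix (Fin p) (Fin p) ℝ}
    {N : Matrix (Fin q) (Fin q) ℝ} {μ : Fin p → ℝ} {ν : Fin q → ℝ}
    (hM : IsEigSeq M μ) (hN : IsEigSeq N ν) (L : (Fin p → ℝ) →ₗ[ℝ] (Fin q → ℝ))
    (k : Fin p) (l : Fin q) (hkl : (k : ℕ) = l) :
    ∃ x : Fin p → ℝ, x ≠ 0 ∧ x ⬝ᵥ M.mulVec x ≤ μ k * (x ⬝ᵥ x) ∧
      ν l * (L x ⬝ᵥ L x) ≤ L x ⬝ᵥ N.mulVec (L x) := by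
  obtain ⟨V, hV⟩ := hM.exists_coordinates
  obtain ⟨U, hU⟩ := hN.exists_coordinates
  let F : (Fin p → ℝ) →ₗ[ℝ] (({i : Fin p // k < i} ⊕ {j : Fin q // j < l}) → ℝ) :=
    LinearMap.pi (Sum.elim (fun i => LinearMap.proj i.1 ∘ₗ V.mulVecLin)
      (fun j => LinearMap.proj j.1 ∘ₗ U.mulVecLin ∘ₗ L))
  have hcard : Module.finrank ℝ (({i : Fin p // k < i} ⊕ {j : Fin q // j < l}) → ℝ)
      < Module.finrank ℝ (Fin p → ℝ) := by
    have h1 : Fintype.card {i : Fin p // k < i} = p - 1 - k := by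
      rw [Fintype.card_subtype, ← Fin.card_Ioi k]
      congr 1
      ext i
      simp
    have h2 : Fintype.card {j : Fin q // j < l} = l := by
      rw [Fintype.card_subtype, ← Fin.card_Iio l]
      congr 1
      ext i
      simp
    rw [Module.finrank_fintype_fun_eq_card, Module.finrank_fintype_fun_eq_card,
      Fintype.card_sum, h1, h2, Fintype.card_fin]
    have := k.2
    omega
  obtain ⟨x, hx, hx0⟩ := Submodule.exists_mem_ne_zero_of_ne_bot
    (LinearMap.ker_ne_bot_of_finrank_lt (f := F) hcard)
  have hF : F x = 0 := hx
  refine ⟨x, hx0, ?_, ?_⟩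
  · rw [(hV x).1, (hV x).2, Finset.mul_sum]
    refine Finset.sum_le_sum fun i _ => ?_
    rcases le_or_gt i k with hik | hik
    · exact mul_le_mul_of_nonneg_right (hM.1 hik) (sq_nonneg _)
    · have h0 : V.mulVec x i = 0 := congrFun hF (Sum.inl ⟨i, hik⟩)
      simp [h0]
  · rw [(hU (L x)).1, (hU (L x)).2, Finset.mul_sum]
    refine Finset.sum_le_sum fun j _ => ?_
    rcases le_or_gt l j with hjl | hjl
    · exact mul_le_mul_of_nonneg_right (hN.1 hjl) (sq_nonneg _)
    · have h0 : U.mulVec (L x) j = 0 := congrFun hF (Sum.inr ⟨j, hjl⟩)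
      simp [h0]

/-- A quadratic form whose coefficients are bounded by `c` is bounded by `n * c`. -/
theorem abs_dotProduct_mulVec_le {n : ℕ} {E : Matrix (Fin n) (Fin n) ℝ} {c : ℝ}
    (hE : ∀ i j, |E i j| ≤ c) (hc : 0 ≤ c) (x : Fin n → ℝ) :
    |x ⬝ᵥ E.mulVec x| ≤ n * c * (x ⬝ᵥ x) := by
  have h1 : |x ⬝ᵥ E.mulVec x| ≤ c * (∑ i, |x i|) ^ 2 := by
    simp only [dotProduct, Matrix.mulVec]
    calc |∑ i, x i * ∑ j, E i j * x j| ≤ ∑ i, |x i * ∑ j, E i j * x j| :=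
          Finset.abs_sum_le_sum_abs _ _
      _ ≤ ∑ i, |x i| * (c * ∑ j, |x j|) := by
          refine Finset.sum_le_sum fun i _ => ?_
          rw [abs_mul]
          refine mul_le_mul_of_nonneg_left ?_ (abs_nonneg _)
          rw [Finset.mul_sum]
          refine (Finset.abs_sum_le_sum_abs _ _).trans (Finset.sum_le_sum fun j _ => ?_)
          rw [abs_mul]
          exact mul_le_mul_of_nonneg_right (hE i j) (abs_nonneg _)
      _ = _ := by rw [← Finset.sum_mul]; ring
  have h2 : (∑ i, |x i|) ^ 2 ≤ n * (x ⬝ᵥ x) := by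
    have := sq_sum_le_card_mul_sum_sq (s := Finset.univ) (f := fun i => |x i|)
    simpa [dotProduct, sq] using this
  calc _ ≤ _ := h1
    _ ≤ c * (n * (x ⬝ᵥ x)) := mul_le_mul_of_nonneg_left h2 hc
    _ = _ := by ring

/-- Completing the square in the last coordinate. -/
theorem dotProduct_mulVec_eq_schur {m : ℕ} {M : Matrix (Fin (m + 2)) (Fin (m + 2)) ℝ}
    (hM : M.IsSymm) {t b : ℝ} (ht : t ≠ 0)
    (hb : M (Fin.last m).castSucc (Fin.last (m + 1)) = b)
    (h0 : ∀ i : Fin (m + 1), i ≠ Fin.last m → M i.castSucc (Fin.last (m + 1)) = 0)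
    (ht' : M (Fin.last (m + 1)) (Fin.last (m + 1)) = (t ^ 2)⁻¹)
    (x : Fin (m + 1) → ℝ) (z : Fin (m + 2) → ℝ) (hz : ∀ i, z (Fin.castSucc i) = x i) :
    z ⬝ᵥ M.mulVec z =
      x ⬝ᵥ (M.submatrix Fin.castSucc Fin.castSucc
        - Matrix.single (Fin.last m) (Fin.last m) (t ^ 2 * b ^ 2)).mulVec x
      + (z (Fin.last (m + 1)) / t + t * b * x (Fin.last m)) ^ 2 := by
  have hs : ∀ i : Fin (m + 1), M (Fin.last (m + 1)) i.castSucc = M i.castSucc (Fin.last (m + 1)) :=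
    fun i => hM.apply _ _
  have hsum : ∑ i : Fin (m + 1), M i.castSucc (Fin.last (m + 1)) * x i = b * x (Fin.last m) := by
    rw [Finset.sum_eq_single (Fin.last m) (fun i _ hi => by rw [h0 i hi, zero_mul]) (by simp), hb]
  have hsingle : x ⬝ᵥ (Matrix.single (Fin.last m) (Fin.last m) (t ^ 2 * b ^ 2)).mulVec x
      = t ^ 2 * b ^ 2 * x (Fin.last m) ^ 2 := by
    rw [Matrix.single_mulVec]
    simp [dotProduct, Function.update_apply]
    ring
  rw [Matrix.sub_mulVec, dotProduct_sub, hsingle]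
  simp only [dotProduct, Matrix.mulVec, Fin.sum_univ_castSucc (n := m + 1), hz, hs, hsum, ht',
    Matrix.submatrix_apply, mul_add, Finset.sum_add_distrib]
  have hsum' : ∑ i : Fin (m + 1), x i * (M i.castSucc (Fin.last (m + 1)) * z (Fin.last (m + 1)))
      = b * x (Fin.last m) * z (Fin.last (m + 1)) := by
    rw [← hsum, Finset.sum_mul]
    exact Finset.sum_congr rfl fun i _ => by ring
  rw [hsum']
  field_simp
  ring

/-- Quantitative eigenvalue comparison when the Schur complement of the last coordinate is
entrywise close to `A`. -/
theorem IsEigSeq.abs_sub_le_of_schur {m : ℕ} {A : Matrix (Fin (m + 1)) (Fin (m + 1)) ℝ}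
    {lam : Fin (m + 1) → ℝ} (hA : IsEigSeq A lam)
    {M : Matrix (Fin (m + 2)) (Fin (m + 2)) ℝ} {μ : Fin (m + 2) → ℝ} (hMμ : IsEigSeq M μ)
    (hM : M.IsSymm) {t b C : ℝ} (ht : 0 < t) (hC : 0 ≤ C)
    (hb : M (Fin.last m).castSucc (Fin.last (m + 1)) = b)
    (h0 : ∀ i : Fin (m + 1), i ≠ Fin.last m → M i.castSucc (Fin.last (m + 1)) = 0)
    (ht' : M (Fin.last (m + 1)) (Fin.last (m + 1)) = (t ^ 2)⁻¹)
    (hE : ∀ i j, |(M.submatrix Fin.castSucc Fin.castSucc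
        - Matrix.single (Fin.last m) (Fin.last m) (t ^ 2 * b ^ 2) - A) i j| ≤ C * t)
    (hbC : t ^ 4 * b ^ 2 ≤ C * t) (k : Fin (m + 1)) (hk : 2 * |lam k| * t ^ 2 ≤ 1) :
    |μ k.castSucc - lam k| ≤ ((m + 1) * C + 2 * |lam k| * C) * t := by
  set S := M.submatrix Fin.castSucc Fin.castSucc
        - Matrix.single (Fin.last m) (Fin.last m) (t ^ 2 * b ^ 2) with hS
  have hform : ∀ x : Fin (m + 1) → ℝ,
      |x ⬝ᵥ S.mulVec x - x ⬝ᵥ A.mulVec x| ≤ (m + 1) * (C * t) * (x ⬝ᵥ x) := fun x => by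
    rw [← dotProduct_sub, ← Matrix.sub_mulVec]
    simpa using abs_dotProduct_mulVec_le hE (by positivity) x
  have hlast : ∀ x : Fin (m + 1) → ℝ, x (Fin.last m) ^ 2 ≤ x ⬝ᵥ x := fun x => by
    simp only [dotProduct, ← sq]
    exact Finset.single_le_sum (f := fun i => x i ^ 2) (fun i _ => sq_nonneg _)
      (Finset.mem_univ _)
  have hnorm : ∀ (x : Fin (m + 1) → ℝ) (z : Fin (m + 2) → ℝ), (∀ i, z (Fin.castSucc i) = x i) →
      z ⬝ᵥ z = x ⬝ᵥ x + z (Fin.last (m + 1)) ^ 2 := fun x z hz => by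
    simp only [dotProduct, Fin.sum_univ_castSucc (n := m + 1), hz, sq]
  have hpos : ∀ {n : ℕ} (x : Fin n → ℝ), x ≠ 0 → 0 < x ⬝ᵥ x := fun x hx =>
    lt_of_le_of_ne (by simp only [dotProduct, ← sq]; positivity)
      (fun h => hx (dotProduct_self_eq_zero.mp h.symm))
  have hCt : 0 ≤ C * t := by positivity
  have hl := abs_nonneg (lam k)
  have hl1 := neg_abs_le (lam k)
  have hl2 := le_abs_self (lam k)
  rw [abs_sub_le_iff]
  constructor
  · let L : (Fin (m + 1) → ℝ) →ₗ[ℝ] (Fin (m + 2) → ℝ) :=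
      LinearMap.pi (Fin.snoc (α := fun _ => (Fin (m + 1) → ℝ) →ₗ[ℝ] ℝ)
        (fun i => LinearMap.proj i) (-(t ^ 2 * b) • LinearMap.proj (Fin.last m)))
    obtain ⟨x, hx0, hxA, hxM⟩ := hA.exists_test_vector hMμ L k k.castSucc rfl
    have hLx : ∀ i, L x (Fin.castSucc i) = x i := fun i => by simp [L]
    have hLl : L x (Fin.last (m + 1)) = -(t ^ 2 * b) * x (Fin.last m) := by simp [L]
    rw [dotProduct_mulVec_eq_schur hM ht.ne' hb h0 ht' x (L x) hLx, ← hS] at hxM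
    have hw : L x (Fin.last (m + 1)) / t + t * b * x (Fin.last m) = 0 := by
      rw [hLl]
      field_simp
      ring
    have hy : L x (Fin.last (m + 1)) ^ 2 ≤ C * t * (x ⬝ᵥ x) := by
      calc L x (Fin.last (m + 1)) ^ 2 = t ^ 4 * b ^ 2 * x (Fin.last m) ^ 2 := by
            rw [hLl]; ring
        _ ≤ _ := mul_le_mul hbC (hlast x) (sq_nonneg _) hCt
    have hn := hnorm x (L x) hLx
    have hx := hpos x hx0
    have hf := (abs_le.mp (hform x)).2
    rw [hw] at hxM
    set X := x ⬝ᵥ x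
    set Z := L x ⬝ᵥ L x
    set Y := L x (Fin.last (m + 1)) ^ 2
    have hY : 0 ≤ Y := sq_nonneg _
    have hZ : 0 < Z := by linarith
    refine le_of_mul_le_mul_right ?_ hZ
    have e1 : -(lam k) * Y ≤ |lam k| * (C * t * X) :=
      (mul_le_mul_of_nonneg_right (by linarith) hY).trans (mul_le_mul_of_nonneg_left hy hl)
    have e2 : 0 ≤ ((m + 1) * C + 2 * |lam k| * C) * t * Y := by positivity
    have e3 : 0 ≤ |lam k| * (C * t * X) := by positivity
    rw [hn] at hxM ⊢
    nlinarith
  · let L : (Fin (m + 2) → ℝ) →ₗ[ℝ] (Fin (m + 1) → ℝ) := LinearMap.funLeft ℝ ℝ Fin.castSucc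
    obtain ⟨z, hz0, hzM, hzA⟩ := hMμ.exists_test_vector hA L k.castSucc k rfl
    have hLz : ∀ i, z (Fin.castSucc i) = L z i := fun i => rfl
    rw [dotProduct_mulVec_eq_schur hM ht.ne' hb h0 ht' (L z) z hLz, ← hS] at hzM
    set x := L z
    set w := z (Fin.last (m + 1)) / t + t * b * x (Fin.last m) with hw
    have hyw : z (Fin.last (m + 1)) = t * w - t ^ 2 * b * x (Fin.last m) := by
      rw [hw]
      field_simp
      ring
    have hy : z (Fin.last (m + 1)) ^ 2 ≤ 2 * t ^ 2 * w ^ 2 + 2 * (C * t * (x ⬝ᵥ x)) := by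
      have : t ^ 4 * b ^ 2 * x (Fin.last m) ^ 2 ≤ C * t * (x ⬝ᵥ x) :=
        mul_le_mul hbC (hlast x) (sq_nonneg _) hCt
      rw [hyw]
      nlinarith [sq_nonneg (t * w + t ^ 2 * b * x (Fin.last m))]
    have hn := hnorm x z hLz
    have hZ := hpos z hz0
    have hf := (abs_le.mp (hform x)).1
    have hX : 0 ≤ x ⬝ᵥ x := (sq_nonneg _).trans (hlast x)
    set X := x ⬝ᵥ x
    set Z := z ⬝ᵥ z
    set Y := z (Fin.last (m + 1)) ^ 2
    have hY : 0 ≤ Y := sq_nonneg _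
    refine le_of_mul_le_mul_right ?_ hZ
    have e1 : lam k * Y ≤ |lam k| * (2 * t ^ 2 * w ^ 2 + 2 * (C * t * X)) :=
      (mul_le_mul_of_nonneg_right hl2 hY).trans (mul_le_mul_of_nonneg_left hy hl)
    have e2 : 0 ≤ ((m + 1) * C + 2 * |lam k| * C) * t * Y := by positivity
    have e3 : 2 * |lam k| * t ^ 2 * w ^ 2 ≤ 1 * w ^ 2 :=
      mul_le_mul_of_nonneg_right hk (sq_nonneg _)
    rw [hn] at hzM ⊢
    nlinarith

/-- Size of the coupling `b` and of the defect of the Schur complement, with `s = √t` and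
`a = √α`. -/
theorem coupling_estimates {a s K b d : ℝ} (ha : 0 < a) (hs : 0 < s) (hs1 : s ≤ 1) (hK : 0 < K)
    (hb : |b + (1 / (a * s ^ 3)) * (1 - s ^ 2 / (2 * a ^ 2))| ≤ K * s)
    (hd : |d - (1 / (a ^ 2 * s ^ 2)) * (1 - s ^ 2 / a ^ 2)| ≤ K * s ^ 2) :
    |d - s ^ 4 * b ^ 2| ≤
        (K + 1 / (4 * a ^ 6) + 2 * K * ((1 + 1 / (2 * a ^ 2)) / a) + K ^ 2) * s ^ 2 ∧
      s ^ 8 * b ^ 2 ≤ ((1 + 1 / (2 * a ^ 2)) / a + K) ^ 2 * s ^ 2 := by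
  set D := (1 + 1 / (2 * a ^ 2)) / a with hD
  have hD0 : 0 < D := by positivity
  set γ := (1 / a) * (1 - s ^ 2 / (2 * a ^ 2)) with hγ
  have hs2 : s ^ 2 ≤ 1 := pow_le_one₀ hs.le hs1
  have hγD : |γ| ≤ D := by
    rw [hγ, hD, abs_mul, abs_of_pos (by positivity : (0 : ℝ) < 1 / a), one_div_mul_eq_div]
    refine div_le_div_of_nonneg_right ?_ ha.le
    have h1 : 0 ≤ s ^ 2 / (2 * a ^ 2) := by positivity
    have h2 : s ^ 2 / (2 * a ^ 2) ≤ 1 / (2 * a ^ 2) := by gcongr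
    rw [abs_le]
    constructor <;> linarith
  obtain ⟨r, hr⟩ : ∃ r, r = b + (1 / (a * s ^ 3)) * (1 - s ^ 2 / (2 * a ^ 2)) := ⟨_, rfl⟩
  rw [← hr] at hb
  have hbr : s ^ 3 * b = s ^ 3 * r - γ := by
    rw [hr, hγ]
    field_simp
    ring
  have hr2 : r ^ 2 ≤ K ^ 2 * s ^ 2 := by
    rw [← mul_pow]
    exact sq_le_sq' (abs_le.mp hb).1 (abs_le.mp hb).2
  have hγr : |γ * r| ≤ D * (K * s) := by
    rw [abs_mul]
    exact mul_le_mul hγD hb (abs_nonneg _) hD0.le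
  constructor
  · have key : d - s ^ 4 * b ^ 2 = (d - (1 / (a ^ 2 * s ^ 2)) * (1 - s ^ 2 / a ^ 2))
        - 1 / (4 * a ^ 6) * s ^ 2 + 2 * s * (γ * r) - s ^ 4 * r ^ 2 := by
      have hb' : b = r - γ / s ^ 3 := by
        field_simp
        linarith
      rw [hb', hγ]
      field_simp
      ring
    have h1 : |2 * s * (γ * r)| ≤ 2 * K * D * s ^ 2 := by
      rw [abs_mul, abs_of_pos (by positivity : 0 < 2 * s)]
      nlinarith
    have h2 : s ^ 4 * r ^ 2 ≤ K ^ 2 * s ^ 2 := by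
      have : s ^ 4 ≤ 1 := pow_le_one₀ hs.le hs1
      nlinarith [sq_nonneg r]
    have h3 : 0 ≤ s ^ 4 * r ^ 2 := by positivity
    have h4 : 0 ≤ 1 / (4 * a ^ 6) * s ^ 2 := by positivity
    have h5 : 0 ≤ K ^ 2 * s ^ 2 := by positivity
    rw [key, abs_le]
    obtain ⟨h6, h7⟩ := abs_le.mp h1
    obtain ⟨h8, h9⟩ := abs_le.mp hd
    constructor <;> linarith
  · have h1 : |s ^ 3 * b| ≤ D + K := by
      rw [hbr]
      have h3 : |s ^ 3 * r| ≤ K := by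
        rw [abs_mul, abs_of_pos (by positivity : 0 < s ^ 3)]
        have h4 : |r| ≤ K := hb.trans (by nlinarith)
        have : s ^ 3 ≤ 1 := pow_le_one₀ hs.le hs1
        nlinarith [abs_nonneg r]
      exact (abs_sub _ _).trans (by linarith)
    have h2 : (s ^ 3 * b) ^ 2 ≤ (D + K) ^ 2 := sq_le_sq' (abs_le.mp h1).1 (abs_le.mp h1).2
    calc s ^ 8 * b ^ 2 = (s ^ 3 * b) ^ 2 * s ^ 2 := by ring
      _ ≤ _ := mul_le_mul_of_nonneg_right h2 (sq_nonneg s)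

/-- Under the hypotheses on the family `Ã(t)` (see the paper's Proposition), for every
`k` with `0 ≤ k ≤ n−1` the eigenvalue `λ̃_k(t)` of `Ã(t)` converges to the eigenvalue
`λ_k` of `A` as `t → 0⁺`. -/
theorem eigenvalues_tendsto_of_perturbation (m : ℕ)
    (A : Matrix (Fin (m + 1)) (Fin (m + 1)) ℝ) (hA : A.IsSymm)
    (lam : Fin (m + 1) → ℝ) (hlam : IsEigSeq A lam)
    (α ε K : ℝ) (hα : 0 < α) (hε : 0 < ε) (hK : 0 < K)
    (At : ℝ → Matrix (Fin (m + 2)) (Fin (m + 2)) ℝ)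
    (hAtSymm : ∀ t ∈ Set.Ioo (0 : ℝ) ε, (At t).IsSymm)
    (h1 : ∀ t ∈ Set.Ioo (0 : ℝ) ε, ∀ i j : Fin (m + 1),
      ¬(i = Fin.last m ∧ j = Fin.last m) →
      |At t i.castSucc j.castSucc - A i j| ≤ K * t)
    (h2 : ∀ t ∈ Set.Ioo (0 : ℝ) ε,
      |At t (Fin.last m).castSucc (Fin.last m).castSucc - A (Fin.last m) (Fin.last m)
        - (1 / (α * t)) * (1 - t / α)| ≤ K * t)
    (h3 : ∀ t ∈ Set.Ioo (0 : ℝ) ε,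
      |At t (Fin.last m).castSucc (Fin.last (m + 1))
        + (1 / (Real.sqrt α * t ^ ((3 : ℝ) / 2))) * (1 - t / (2 * α))| ≤ K * Real.sqrt t)
    (h4 : ∀ t ∈ Set.Ioo (0 : ℝ) ε, ∀ i : Fin (m + 1), i ≠ Fin.last m →
      At t i.castSucc (Fin.last (m + 1)) = 0)
    (h5 : ∀ t ∈ Set.Ioo (0 : ℝ) ε, At t (Fin.last (m + 1)) (Fin.last (m + 1)) = (t ^ 2)⁻¹)
    (lamt : ℝ → Fin (m + 2) → ℝ)
    (hlamt : ∀ t ∈ Set.Ioo (0 : ℝ) ε, IsEigSeq (At t) (lamt t)) :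
    ∀ k : Fin (m + 1),
      Filter.Tendsto (fun t : ℝ => lamt t k.castSucc)
        (nhdsWithin 0 (Set.Ioi 0)) (nhds (lam k)) := by
  intro k
  set a := Real.sqrt α
  have ha0 : 0 < a := Real.sqrt_pos.mpr hα
  have haα : a ^ 2 = α := Real.sq_sqrt hα.le
  set C₁ := K + 1 / (4 * a ^ 6) + 2 * K * ((1 + 1 / (2 * a ^ 2)) / a) + K ^ 2
  set C₂ := ((1 + 1 / (2 * a ^ 2)) / a + K) ^ 2
  have hC₁K : K ≤ C₁ := by
    have : 0 ≤ 1 / (4 * a ^ 6) + 2 * K * ((1 + 1 / (2 * a ^ 2)) / a) + K ^ 2 := by positivity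
    linarith
  have hC₂0 : 0 ≤ C₂ := sq_nonneg _
  set C := C₁ + C₂
  have hC : 0 ≤ C := by linarith
  have hsmall : ∀ᶠ t : ℝ in 𝓝[>] 0, 2 * |lam k| * t ^ 2 ≤ 1 := by
    have h : Tendsto (fun t : ℝ => 2 * |lam k| * t ^ 2) (𝓝[>] 0) (𝓝 0) :=
      ((by fun_prop : Continuous fun t : ℝ => 2 * |lam k| * t ^ 2).tendsto' 0 0
        (by simp)).mono_left nhdsWithin_le_nhds
    exact (h.eventually (gt_mem_nhds one_pos)).mono fun t ht => ht.le
  have hbound : ∀ᶠ t : ℝ in 𝓝[>] 0,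
      |lamt t k.castSucc - lam k| ≤ ((m + 1) * C + 2 * |lam k| * C) * t := by
    filter_upwards [hsmall, Ioo_mem_nhdsGT hε, Ioo_mem_nhdsGT one_pos] with t hk ht ht1
    have ht0 : 0 < t := ht.1
    set s := Real.sqrt t with hs
    have hs0 : 0 < s := Real.sqrt_pos.mpr ht0
    have hst : s ^ 2 = t := Real.sq_sqrt ht0.le
    have hs1 : s ≤ 1 := Real.sqrt_le_one.mpr ht1.2.le
    have hs3 : t ^ ((3 : ℝ) / 2) = s ^ 3 := by
      rw [hs, Real.sqrt_eq_rpow, ← Real.rpow_natCast, ← Real.rpow_mul ht0.le]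
      norm_num
    obtain ⟨hE, hB⟩ := coupling_estimates ha0 hs0 hs1 hK
      (b := At t (Fin.last m).castSucc (Fin.last (m + 1)))
      (d := At t (Fin.last m).castSucc (Fin.last m).castSucc - A (Fin.last m) (Fin.last m))
      (by simpa only [hst, haα, hs3] using h3 t ht) (by simpa only [hst, haα] using h2 t ht)
    rw [show s ^ 4 = (s ^ 2) ^ 2 by ring, hst] at hE
    rw [show s ^ 8 = (s ^ 2) ^ 4 by ring, hst] at hB
    refine hlam.abs_sub_le_of_schur (hlamt t ht) (hAtSymm t ht) ht0 hC rfl (h4 t ht) (h5 t ht)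
      (fun i j => ?_) (hB.trans (mul_le_mul_of_nonneg_right (by linarith) ht0.le)) k hk
    by_cases hij : i = Fin.last m ∧ j = Fin.last m
    · obtain ⟨rfl, rfl⟩ := hij
      rw [Matrix.sub_apply, Matrix.sub_apply, Matrix.submatrix_apply, Matrix.single_apply_same,
        sub_right_comm]
      exact hE.trans (mul_le_mul_of_nonneg_right (by linarith) ht0.le)
    · rw [Matrix.sub_apply, Matrix.sub_apply, Matrix.submatrix_apply,
        Matrix.single_apply_of_ne _ _ _ _ _ (fun h => hij ⟨h.1.symm, h.2.symm⟩), sub_zero]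
      exact (h1 t ht i j hij).trans (mul_le_mul_of_nonneg_right (by linarith) ht0.le)
  rw [tendsto_iff_dist_tendsto_zero]
  refine squeeze_zero' (Eventually.of_forall fun _ => dist_nonneg)
    (hbound.mono fun t ht => (Real.dist_eq _ _).trans_le ht) ?_
  exact ((by fun_prop : Continuous fun t : ℝ => ((m + 1) * C + 2 * |lam k| * C) * t).tendsto' 0 0
    (by simp)).mono_left nhdsWithin_le_nhds

end
end

section
/- Under the stated hypotheses on the family Ã(t), there exist constants C > 0 and ε′ ∈ (0, ε] such that for all t ∈ (0, ε′) and all k with 1 ≤ k ≤ n−1, the eigenvalue λ̃_k(t) of Ã(t) satisfies λ̃_k(t) ≥ λ_k − C√t. -/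
open Filter Topology

noncomputable section

open Matrix in
/-- An eigenvalue sequence diagonalizes the quadratic form in Euclidean coordinates. -/
theorem IsEigSeq.exists_diagonalization {m : ℕ} {M : Matrix (Fin m) (Fin m) ℝ} {μ : Fin m → ℝ}
    (h : IsEigSeq M μ) : ∃ U : Matrix (Fin m) (Fin m) ℝ,
      (∀ x, x ⬝ᵥ x = ∑ i, (U *ᵥ x) i ^ 2) ∧
      ∀ x, x ⬝ᵥ M *ᵥ x = ∑ i, μ i * (U *ᵥ x) i ^ 2 := by
  obtain ⟨-, v, hv, ho⟩ := h
  have hU : of v * (of v)ᵀ = 1 := by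
    ext i j
    simp [mul_apply, ho, one_apply]
  have hU' : (of v)ᵀ * of v = 1 := mul_eq_one_comm.mp hU
  have hMU : M * (of v)ᵀ = (of v)ᵀ * diagonal μ := by
    ext j i
    have := congrFun (hv i) j
    rw [mul_diagonal, transpose_apply, of_apply, mul_comm (v i j)]
    exact this
  have hM : M = (of v)ᵀ * diagonal μ * of v := by
    rw [← hMU, Matrix.mul_assoc, hU', Matrix.mul_one]
  refine ⟨of v, fun x => ?_, fun x => ?_⟩
  · have : x ⬝ᵥ x = x ⬝ᵥ ((of v)ᵀ * of v) *ᵥ x := by rw [hU', one_mulVec]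
    rw [this, ← mulVec_mulVec, dotProduct_mulVec, vecMul_transpose]
    simp [dotProduct, sq]
  · rw [hM, Matrix.mul_assoc, ← mulVec_mulVec, ← mulVec_mulVec, dotProduct_mulVec,
      vecMul_transpose]
    simp only [dotProduct, mulVec_diagonal]
    exact Finset.sum_congr rfl fun i _ => by ring

open Matrix in
/-- A dimension count in the spirit of Courant–Fischer: some nonzero vector has Rayleigh quotient
at most the `k`-th eigenvalue of `M`, while its truncation has Rayleigh quotient at least the
`k`-th eigenvalue of `A`. -/
theorem IsEigSeq.exists_rayleigh_le_and_le {m : ℕ}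
    {A : Matrix (Fin (m + 1)) (Fin (m + 1)) ℝ} {lam : Fin (m + 1) → ℝ} (hA : IsEigSeq A lam)
    {M : Matrix (Fin (m + 2)) (Fin (m + 2)) ℝ} {μ : Fin (m + 2) → ℝ} (hM : IsEigSeq M μ)
    (k : Fin (m + 1)) : ∃ x : Fin (m + 2) → ℝ, 0 < x ⬝ᵥ x ∧
      x ⬝ᵥ M *ᵥ x ≤ μ k.castSucc * (x ⬝ᵥ x) ∧
      lam k * (Fin.init x ⬝ᵥ Fin.init x) ≤ (Fin.init x : Fin (m + 1) → ℝ) ⬝ᵥ A *ᵥ Fin.init x := by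
  obtain ⟨U, hU, hUA⟩ := hA.exists_diagonalization
  obtain ⟨W, hW, hWM⟩ := hM.exists_diagonalization
  let f : (Fin (m + 2) → ℝ) →ₗ[ℝ] (Fin (m + 1) → ℝ) := LinearMap.pi fun i =>
    if i < k then LinearMap.proj i ∘ₗ U.mulVecLin ∘ₗ LinearMap.funLeft ℝ ℝ Fin.castSucc
    else LinearMap.proj i.succ ∘ₗ W.mulVecLin
  have hker : f.ker ≠ ⊥ := LinearMap.ker_ne_bot_of_finrank_lt (by simp)
  obtain ⟨x, hx, hx0⟩ := (Submodule.ne_bot_iff _).mp hker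
  have hlt : ∀ i < k, (U *ᵥ (Fin.init x : Fin (m + 1) → ℝ)) i = 0 := fun i hi => by
    have := congrFun (LinearMap.mem_ker.mp hx) i
    simp only [f, LinearMap.pi_apply, if_pos hi] at this
    exact this
  have hge : ∀ i, k ≤ i → (W *ᵥ x) i.succ = 0 := fun i hi => by
    have := congrFun (LinearMap.mem_ker.mp hx) i
    simpa [f, not_lt.mpr hi] using this
  refine ⟨x, ?_, ?_, ?_⟩
  · have h0 : 0 ≤ x ⬝ᵥ x := Finset.sum_nonneg fun i _ => mul_self_nonneg _
    exact h0.lt_of_ne fun h => hx0 (dotProduct_self_eq_zero.mp h.symm)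
  · rw [hW, hWM, Finset.mul_sum]
    refine Finset.sum_le_sum fun i _ => ?_
    rcases le_or_gt i k.castSucc with hi | hi
    · exact mul_le_mul_of_nonneg_right (hM.1 hi) (sq_nonneg _)
    · obtain ⟨j, rfl⟩ := Fin.exists_succ_eq_of_ne_zero (Fin.ne_zero_of_lt hi)
      rw [hge j (Fin.castSucc_lt_succ_iff.mp hi)]
      simp
  · rw [hU, hUA, Finset.mul_sum]
    refine Finset.sum_le_sum fun i _ => ?_
    rcases lt_or_ge i k with hi | hi
    · simp [hlt i hi]
    · exact mul_le_mul_of_nonneg_right (hA.1 hi) (sq_nonneg _)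

open Matrix in
/-- A quadratic form with entries bounded by `δ` is at least `-δ * n` times the squared norm. -/
theorem neg_mul_card_le_dotProduct_mulVec {n : ℕ} {E : Matrix (Fin n) (Fin n) ℝ} {δ : ℝ}
    (hE : ∀ i j, |E i j| ≤ δ) (y : Fin n → ℝ) :
    -(δ * n) * (y ⬝ᵥ y) ≤ y ⬝ᵥ E *ᵥ y := by
  have hterm : ∀ i j, -(δ * ((y i ^ 2 + y j ^ 2) / 2)) ≤ y i * (E i j * y j) := fun i j => by
    have h : |y i * (E i j * y j)| ≤ δ * ((y i ^ 2 + y j ^ 2) / 2) := by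
      have h2 : |y i| * |y j| ≤ (y i ^ 2 + y j ^ 2) / 2 := by
        nlinarith [sq_nonneg (|y i| - |y j|), sq_abs (y i), sq_abs (y j)]
      calc |y i * (E i j * y j)| = |E i j| * (|y i| * |y j|) := by
            rw [abs_mul, abs_mul]; ring
        _ ≤ δ * ((y i ^ 2 + y j ^ 2) / 2) :=
            mul_le_mul (hE i j) h2 (by positivity) ((abs_nonneg _).trans (hE i j))
    exact (abs_le.mp h).1
  calc -(δ * n) * (y ⬝ᵥ y) = ∑ i, ∑ j, -(δ * ((y i ^ 2 + y j ^ 2) / 2)) := by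
        simp only [Finset.sum_neg_distrib, ← Finset.mul_sum, ← Finset.sum_div,
          Finset.sum_add_distrib, Finset.sum_const, Finset.card_univ, Fintype.card_fin,
          nsmul_eq_mul, dotProduct, ← sq]
        ring
    _ ≤ ∑ i, ∑ j, y i * (E i j * y j) :=
        Finset.sum_le_sum fun i _ => Finset.sum_le_sum fun j _ => hterm i j
    _ = y ⬝ᵥ E *ᵥ y := by simp only [dotProduct, mulVec, Finset.mul_sum]

open Matrix in
/-- Expansion of the quadratic form of a symmetric matrix whose last column vanishes above its
last two entries. -/
theorem dotProduct_mulVec_eq_of_last_column {m : ℕ} {M : Matrix (Fin (m + 2)) (Fin (m + 2)) ℝ}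
    (hM : M.IsSymm) (hcol : ∀ i : Fin (m + 1), i ≠ Fin.last m → M i.castSucc (Fin.last (m + 1)) = 0)
    (x : Fin (m + 2) → ℝ) :
    x ⬝ᵥ M *ᵥ x =
      (Fin.init x : Fin (m + 1) → ℝ) ⬝ᵥ M.submatrix Fin.castSucc Fin.castSucc *ᵥ Fin.init x
      + 2 * x (Fin.last (m + 1)) * x (Fin.last m).castSucc
        * M (Fin.last m).castSucc (Fin.last (m + 1))
      + x (Fin.last (m + 1)) ^ 2 * M (Fin.last (m + 1)) (Fin.last (m + 1)) := by
  have hs : ∑ i : Fin (m + 1), x i.castSucc * M i.castSucc (Fin.last (m + 1)) =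
      x (Fin.last m).castSucc * M (Fin.last m).castSucc (Fin.last (m + 1)) :=
    Finset.sum_eq_single _ (fun i _ hi => by rw [hcol i hi, mul_zero]) (by simp)
  have hr : ∑ i : Fin (m + 1), M (Fin.last (m + 1)) i.castSucc * x i.castSucc =
      x (Fin.last m).castSucc * M (Fin.last m).castSucc (Fin.last (m + 1)) := by
    rw [← hs]
    exact Finset.sum_congr rfl fun i _ => by rw [hM.apply, mul_comm]
  simp only [dotProduct, mulVec, Fin.init, submatrix_apply]
  rw [Fin.sum_univ_castSucc]
  simp only [Fin.sum_univ_castSucc (n := m + 1), mul_add, Finset.sum_add_distrib]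
  rw [hr]
  simp only [← mul_assoc, ← Finset.sum_mul]
  rw [hs]
  ring

/-- Completing the square in the singular two-dimensional block, with `r = √t` and `a = √α`. -/
theorem singular_block_lower_bound {a r K D L Λ Y u s b Q : ℝ} (ha : 0 < a) (hr : 0 < r)
    (hK : 0 < K) (hL : |L| ≤ Λ) (hra : r ^ 2 ≤ 2 * a ^ 2) (hrK : (K + Λ) * (2 * r ^ 4) ≤ 1)
    (huY : u ^ 2 ≤ Y)
    (hb : |b + 1 / (a * r ^ 3) * (1 - r ^ 2 / (2 * a ^ 2))| ≤ K * r)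
    (hQ : L * Y - D * r ^ 2 * Y + 1 / (a ^ 2 * r ^ 2) * (1 - r ^ 2 / a ^ 2) * u ^ 2
      + 2 * s * u * b + s ^ 2 * (r ^ 4)⁻¹ ≤ Q) :
    (L - (|D| + 1 / (4 * a ^ 6) + K + (K + Λ) * (2 / a ^ 2)) * r ^ 2) * (Y + s ^ 2) ≤ Q := by
  obtain ⟨p, hp⟩ : ∃ p, p = 1 / a * (1 - r ^ 2 / (2 * a ^ 2)) := ⟨_, rfl⟩
  obtain ⟨w, hw⟩ : ∃ w, w = s / r ^ 2 - p / r * u := ⟨_, rfl⟩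
  obtain ⟨e, he⟩ : ∃ e, e = b + 1 / (a * r ^ 3) * (1 - r ^ 2 / (2 * a ^ 2)) := ⟨_, rfl⟩
  rw [← he] at hb
  have hΛ : 0 ≤ Λ := (abs_nonneg L).trans hL
  have hs : s = r ^ 2 * w + r * p * u := by rw [hw]; field_simp; ring
  have hp2 : p ^ 2 ≤ 1 / a ^ 2 := by
    have h0 : 0 ≤ r ^ 2 / (2 * a ^ 2) := by positivity
    have h1 : r ^ 2 / (2 * a ^ 2) ≤ 1 := by rw [div_le_one (by positivity)]; exact hra
    have h2 : (1 - r ^ 2 / (2 * a ^ 2)) ^ 2 ≤ 1 := by nlinarith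
    rw [hp, mul_pow, div_pow, one_pow]
    exact mul_le_of_le_one_right (by positivity) h2
  have hsq : 1 / (a ^ 2 * r ^ 2) * (1 - r ^ 2 / a ^ 2) * u ^ 2 + 2 * s * u * b
      + s ^ 2 * (r ^ 4)⁻¹ = w ^ 2 - r ^ 2 * u ^ 2 * (1 / (4 * a ^ 6)) + 2 * s * u * e := by
    rw [hw, he, hp]; field_simp; ring
  have hcross : -(K * (r ^ 2 * u ^ 2 + s ^ 2)) ≤ 2 * s * u * e := by
    have h : |2 * s * u * e| ≤ K * (r ^ 2 * u ^ 2 + s ^ 2) := by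
      have h1 : |2 * s * u * e| = 2 * (|s| * |u|) * |e| := by
        rw [abs_mul, abs_mul, abs_mul, abs_two]; ring
      have h2 : 2 * (|s| * |u|) * |e| ≤ 2 * (|s| * |u|) * (K * r) := by gcongr
      have h3 : 0 ≤ K * (r * |u| - |s|) ^ 2 := by positivity
      have h4 := sq_abs u
      have h5 := sq_abs s
      rw [h1, ← h4, ← h5]
      linarith [h2, h3]
    exact (abs_le.mp h).1
  have hs2 : s ^ 2 ≤ 2 * r ^ 4 * w ^ 2 + 2 / a ^ 2 * (r ^ 2 * u ^ 2) := by
    have h1 : s ^ 2 ≤ 2 * r ^ 4 * w ^ 2 + 2 * p ^ 2 * (r ^ 2 * u ^ 2) := by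
      rw [hs]; nlinarith [sq_nonneg (r ^ 2 * w - r * p * u)]
    have h2 : p ^ 2 * (r ^ 2 * u ^ 2) ≤ 1 / a ^ 2 * (r ^ 2 * u ^ 2) := by gcongr
    have h3 : 2 / a ^ 2 * (r ^ 2 * u ^ 2) = 2 * (1 / a ^ 2 * (r ^ 2 * u ^ 2)) := by ring
    linarith
  have hs3 : (K + Λ) * s ^ 2 ≤ w ^ 2 + (K + Λ) * (2 / a ^ 2) * (r ^ 2 * u ^ 2) := by
    have h1 := mul_le_mul_of_nonneg_left hs2 (add_nonneg hK.le hΛ)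
    have h2 := mul_le_mul_of_nonneg_right hrK (sq_nonneg w)
    linarith
  have hLs : L * s ^ 2 ≤ Λ * s ^ 2 := by gcongr; exact (le_abs_self L).trans hL
  have hY : 0 ≤ Y := (sq_nonneg u).trans huY
  have hD : D * (r ^ 2 * Y) ≤ |D| * (r ^ 2 * Y) := by gcongr; exact le_abs_self D
  have hru : r ^ 2 * u ^ 2 ≤ r ^ 2 * Y := by gcongr
  have hc : 0 ≤ 1 / (4 * a ^ 6) + K + (K + Λ) * (2 / a ^ 2) := by positivity
  have hu := mul_le_mul_of_nonneg_left hru hc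
  have hrest : 0 ≤ (|D| + 1 / (4 * a ^ 6) + K + (K + Λ) * (2 / a ^ 2)) * (r ^ 2 * s ^ 2) := by
    positivity
  linarith

/-- Under the hypotheses on the family `Ã(t)`, there exist `C > 0` and `ε′ ∈ (0, ε]`
such that for all `t ∈ (0, ε′)` and all `k` with `1 ≤ k ≤ n−1`, the eigenvalue
`λ̃_k(t)` of `Ã(t)` satisfies `λ̃_k(t) ≥ λ_k − C√t`. -/
theorem eigenvalues_lower_bound_of_perturbation (m : ℕ)
    (A : Matrix (Fin (m + 1)) (Fin (m + 1)) ℝ) (hA : A.IsSymm)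
    (lam : Fin (m + 1) → ℝ) (hlam : IsEigSeq A lam)
    (α ε K : ℝ) (hα : 0 < α) (hε : 0 < ε) (hK : 0 < K)
    (At : ℝ → Matrix (Fin (m + 2)) (Fin (m + 2)) ℝ)
    (hAtSymm : ∀ t ∈ Set.Ioo (0 : ℝ) ε, (At t).IsSymm)
    (h1 : ∀ t ∈ Set.Ioo (0 : ℝ) ε, ∀ i j : Fin (m + 1),
      ¬(i = Fin.last m ∧ j = Fin.last m) →
      |At t i.castSucc j.castSucc - A i j| ≤ K * t)
    (h2 : ∀ t ∈ Set.Ioo (0 : ℝ) ε,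
      |At t (Fin.last m).castSucc (Fin.last m).castSucc - A (Fin.last m) (Fin.last m)
        - (1 / (α * t)) * (1 - t / α)| ≤ K * t)
    (h3 : ∀ t ∈ Set.Ioo (0 : ℝ) ε,
      |At t (Fin.last m).castSucc (Fin.last (m + 1))
        + (1 / (Real.sqrt α * t ^ ((3 : ℝ) / 2))) * (1 - t / (2 * α))| ≤ K * Real.sqrt t)
    (h4 : ∀ t ∈ Set.Ioo (0 : ℝ) ε, ∀ i : Fin (m + 1), i ≠ Fin.last m →
      At t i.castSucc (Fin.last (m + 1)) = 0)
    (h5 : ∀ t ∈ Set.Ioo (0 : ℝ) ε, At t (Fin.last (m + 1)) (Fin.last (m + 1)) = (t ^ 2)⁻¹)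
    (lamt : ℝ → Fin (m + 2) → ℝ)
    (hlamt : ∀ t ∈ Set.Ioo (0 : ℝ) ε, IsEigSeq (At t) (lamt t)) :
    ∃ C > (0 : ℝ), ∃ ε' : ℝ, 0 < ε' ∧ ε' ≤ ε ∧
      ∀ t ∈ Set.Ioo (0 : ℝ) ε', ∀ k : Fin (m + 1), 1 ≤ (k : ℕ) →
        lam k - C * Real.sqrt t ≤ lamt t k.castSucc := by
  obtain ⟨Λ, hΛdef⟩ : ∃ Λ, Λ = ∑ i, |lam i| := ⟨_, rfl⟩
  have hΛ : ∀ k, |lam k| ≤ Λ := fun k => hΛdef ▸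
    Finset.single_le_sum (f := fun i => |lam i|) (fun i _ => abs_nonneg _) (Finset.mem_univ k)
  have hΛ0 : 0 ≤ Λ := (abs_nonneg _).trans (hΛ 0)
  obtain ⟨a, ha, rfl⟩ : ∃ a : ℝ, 0 < a ∧ α = a ^ 2 :=
    ⟨√α, Real.sqrt_pos.mpr hα, (Real.sq_sqrt hα.le).symm⟩
  rw [Real.sqrt_sq ha.le] at h3
  obtain ⟨D, hD⟩ : ∃ D : ℝ, D = K * ((m + 1 : ℕ) : ℝ) := ⟨_, rfl⟩
  obtain ⟨C, hC⟩ : ∃ C, C = |D| + 1 / (4 * a ^ 6) + K + (K + Λ) * (2 / a ^ 2) := ⟨_, rfl⟩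
  have hC0 : 0 < C := by rw [hC]; positivity
  refine ⟨C, hC0, min ε (min 1 (min (2 * a ^ 2) (1 / (2 * (K + Λ))))), by positivity,
    min_le_left _ _, fun t ⟨ht0, ht⟩ k _ => ?_⟩
  simp only [lt_min_iff] at ht
  obtain ⟨htε, ht1, hta, htK⟩ := ht
  have hmem : t ∈ Set.Ioo 0 ε := ⟨ht0, htε⟩
  obtain ⟨x, hx0, hxM, hxA⟩ := hlam.exists_rayleigh_le_and_le (hlamt t hmem) k
  obtain ⟨r, hr, rfl⟩ : ∃ r : ℝ, 0 < r ∧ t = r ^ 2 :=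
    ⟨√t, Real.sqrt_pos.mpr ht0, (Real.sq_sqrt ht0.le).symm⟩
  rw [Real.sqrt_sq hr.le]
  have hr1 : r ≤ 1 := by nlinarith
  have hr3 : (r ^ 2) ^ ((3 : ℝ) / 2) = r ^ 3 := by
    rw [← Real.rpow_natCast_mul hr.le, ← Real.rpow_natCast]; norm_num
  have hb := h3 _ hmem
  rw [hr3, Real.sqrt_sq hr.le] at hb
  have hrK : (K + Λ) * (2 * r ^ 4) ≤ 1 := by
    rw [lt_div_iff₀ (by positivity)] at htK
    have h : r ^ 4 ≤ r ^ 2 := pow_le_pow_of_le_one hr.le hr1 (by norm_num)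
    have := mul_le_mul_of_nonneg_left h (add_nonneg hK.le hΛ0)
    linarith
  obtain ⟨y, hy⟩ : ∃ y : Fin (m + 1) → ℝ, y = Fin.init x := ⟨_, rfl⟩
  obtain ⟨β, hβ⟩ : ∃ β, β = 1 / (a ^ 2 * r ^ 2) * (1 - r ^ 2 / a ^ 2) := ⟨_, rfl⟩
  have hulast : x (Fin.last m).castSucc = y (Fin.last m) := by rw [hy]; rfl
  have huY : x (Fin.last m).castSucc ^ 2 ≤ y ⬝ᵥ y := by
    rw [hulast, sq]
    exact Finset.single_le_sum (f := fun i => y i * y i) (fun i _ => mul_self_nonneg _)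
      (Finset.mem_univ _)
  have hxx : x ⬝ᵥ x = y ⬝ᵥ y + x (Fin.last (m + 1)) ^ 2 := by
    rw [hy, sq]; exact Fin.sum_univ_castSucc _
  obtain ⟨E, hE⟩ : ∃ E, E = (At (r ^ 2)).submatrix Fin.castSucc Fin.castSucc - A
      - Matrix.single (Fin.last m) (Fin.last m) β := ⟨_, rfl⟩
  have hEle : ∀ i j, |E i j| ≤ K * r ^ 2 := fun i j => by
    by_cases hij : i = Fin.last m ∧ j = Fin.last m
    · obtain ⟨rfl, rfl⟩ := hij
      simpa [hE, hβ] using h2 _ hmem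
    · have h0 : Matrix.single (Fin.last m) (Fin.last m) β i j = 0 :=
        Matrix.single_apply_of_ne _ _ _ _ _ fun h => hij ⟨h.1.symm, h.2.symm⟩
      simpa [hE, h0] using h1 _ hmem i j hij
  have hsub : (At (r ^ 2)).submatrix Fin.castSucc Fin.castSucc
      = A + E + Matrix.single (Fin.last m) (Fin.last m) β := by rw [hE]; abel
  have hEy := neg_mul_card_le_dotProduct_mulVec hEle y
  have hquad := dotProduct_mulVec_eq_of_last_column (hAtSymm _ hmem) (h4 _ hmem) x
  rw [← hy] at hquad hxA
  rw [hsub, Matrix.add_mulVec, Matrix.add_mulVec, dotProduct_add, dotProduct_add, h5 _ hmem,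
    Matrix.single_mulVec] at hquad
  have hβu : y ⬝ᵥ Function.update 0 (Fin.last m) (β * y (Fin.last m))
      = β * x (Fin.last m).castSucc ^ 2 := by
    rw [hulast, ← Pi.single, dotProduct_single]; ring
  rw [hβu] at hquad
  have hmain := singular_block_lower_bound (Q := x ⬝ᵥ (At (r ^ 2)).mulVec x)
    (s := x (Fin.last (m + 1))) (D := D) ha hr hK (hΛ k) hta.le hrK huY hb (by
      rw [hquad, ← hβ, hD]
      have : ((r ^ 2) ^ 2)⁻¹ = (r ^ 4)⁻¹ := by ring
      rw [this]
      linarith)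
  rw [← hC, ← hxx] at hmain
  have hle : lam k - C * r ^ 2 ≤ lamt (r ^ 2) k.castSucc :=
    le_of_mul_le_mul_right (hmain.trans hxM) hx0
  have : C * r ^ 2 ≤ C * r := by gcongr; nlinarith
  linarith

end
end
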